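/- arXiv:2211.16766 — 2 statements merged into one kernel-verified Lean document; each statement's English description precedes it below -/
import Mathlib

section
/- Let s be the binary m-sequence s_λ = T(π^λ) of period n = 2^m - 1 (m ≥ 2), with arithmetic autocorrelation A_s(τ). Then for every 1 ≤ τ ≤ n-1, A_s(τ) ∈ {±(2^k - 1) : 1 ≤ k ≤ m-1}. -/
def w2 (a : ℕ) : ℕ := (Nat.digits 2 a).sum

def sigma (n : ℕ) (a : ℕ → ℕ) : ℕ := ∑ l ∈ Finset.range n, a l * 2 ^ l

/-- arithmetic autocorrelation of a {0,1}-valued sequence `a` at shift `τ` -/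
def arithAC (n : ℕ) (a : ℕ → ℕ) (τ : ℕ) : ℤ :=
  if sigma n a > sigma n (fun l => a (l + τ)) then
    2 * w2 (sigma n a - sigma n (fun l => a (l + τ))) - (n : ℤ)
  else
    (n : ℤ) - 2 * w2 (sigma n (fun l => a (l + τ)) - sigma n a)

/-- sign character of `ZMod 2` -/
def sg (x : ZMod 2) : ℤ := 1 - 2 * (x.val : ℤ)

lemma sg_add (x y : ZMod 2) : sg (x + y) = sg x * sg y := by revert x y; decide
lemma sg_zero : sg 0 = 1 := by decide

lemma sg_sum {ι : Type*} (s : Finset ι) (f : ι → ZMod 2) :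
    sg (∑ i ∈ s, f i) = ∏ i ∈ s, sg (f i) := by
  classical
  induction s using Finset.induction_on with
  | empty => simp [sg_zero]
  | insert a s ha ih => rw [Finset.sum_insert ha, Finset.prod_insert ha, sg_add, ih]

lemma w2_sigma (n : ℕ) : ∀ (d : ℕ → ZMod 2),
    w2 (sigma n (fun l => (d l).val)) = ∑ l ∈ Finset.range n, (d l).val := by
  induction n with
  | zero => intro d; simp [w2, sigma]
  | succ n ih =>
    intro d
    have h1 : sigma (n+1) (fun l => (d l).val)
        = (d 0).val + 2 * sigma n (fun l => (d (l+1)).val) := by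
      simp only [sigma]
      rw [Finset.sum_range_succ', Finset.mul_sum, add_comm]
      congr 1
      · simp
      · apply Finset.sum_congr rfl; intros; ring
    rw [h1, Finset.sum_range_succ', ← ih (fun l => d (l+1))]
    have h2 : (d 0).val < 2 := ZMod.val_lt _
    generalize sigma n (fun l => (d (l+1)).val) = N
    generalize (d 0).val = x at *
    unfold w2
    rcases Nat.eq_zero_or_pos (x + 2 * N) with h | h
    · have : x = 0 := by omega
      have : N = 0 := by omega
      subst_vars; simp
    · rw [Nat.digits_def' (by norm_num) h]
      have e1 : (x + 2 * N) % 2 = x := by omega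
      have e2 : (x + 2 * N) / 2 = N := by omega
      rw [e1, e2]; simp [add_comm]

/-- borrow sequence -/
def bor (a b : ℕ → ZMod 2) : ℕ → ZMod 2
  | 0 => 0
  | l + 1 => if a l = b l then bor a b l else b l

lemma bor_step (x y c : ZMod 2) : ((x + y + c).val : ℤ)
    = x.val - y.val - c.val + 2 * ((if x = y then c else y).val : ℤ) := by
  revert x y c; decide

lemma bor_sum (a b : ℕ → ZMod 2) (n : ℕ) :
    (sigma n (fun l => (a l + b l + bor a b l).val) : ℤ)
      = sigma n (fun l => (a l).val) - sigma n (fun l => (b l).val) + (bor a b n).val * 2 ^ n := by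
  induction n with
  | zero => simp [sigma, bor]
  | succ n ih =>
    simp only [sigma, Finset.sum_range_succ] at *
    push_cast at *
    rw [ih, bor_step]
    simp only [bor]
    ring

lemma sigma_lt (n : ℕ) (d : ℕ → ZMod 2) : sigma n (fun l => (d l).val) < 2 ^ n := by
  induction n with
  | zero => simp [sigma]
  | succ n ih =>
    simp only [sigma, Finset.sum_range_succ] at *
    have h2 : (d n).val ≤ 1 := Nat.lt_succ_iff.mp (ZMod.val_lt (d n))
    have : (d n).val * 2 ^ n ≤ 1 * 2 ^ n := Nat.mul_le_mul_right _ h2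
    rw [pow_succ]; omega

lemma bor_end (a b : ℕ → ZMod 2) (n : ℕ)
    (h : sigma n (fun l => (b l).val) ≤ sigma n (fun l => (a l).val)) : bor a b n = 0 := by
  have h1 := bor_sum a b n
  have h2 := sigma_lt n (fun l => (a l + b l + bor a b l))
  have h3 : (bor a b n).val < 2 := ZMod.val_lt _
  rw [← ZMod.val_eq_zero]
  by_contra h0
  have h4 : (bor a b n).val = 1 := by omega
  rw [h4] at h1
  have h5 : ((2:ℤ)^n) = ((2^n : ℕ) : ℤ) := by push_cast; rfl
  rw [h5] at h1
  push_cast [-Nat.cast_pow] at h1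
  omega

lemma w2_diff (a b : ℕ → ZMod 2) (n : ℕ)
    (h : sigma n (fun l => (b l).val) ≤ sigma n (fun l => (a l).val)) :
    2 * (w2 (sigma n (fun l => (a l).val) - sigma n (fun l => (b l).val)) : ℤ) - n
      = - ∑ l ∈ Finset.range n, sg (a l + b l + bor a b l) := by
  have h1 := bor_sum a b n
  rw [bor_end a b n h] at h1
  have h2 : sigma n (fun l => (a l).val) - sigma n (fun l => (b l).val)
      = sigma n (fun l => (a l + b l + bor a b l).val) := by
    simp at h1; omega
  rw [h2, w2_sigma]
  simp only [sg, Finset.sum_sub_distrib, ← Finset.mul_sum]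
  simp

lemma sum_shift (n : ℕ) (f : ℕ → ℤ) (h : f n = f 0) :
    ∑ l ∈ Finset.range n, f (l+1) = ∑ l ∈ Finset.range n, f l := by
  have h1 := Finset.sum_range_succ f n
  have h2 := Finset.sum_range_succ' f n
  linarith

lemma bor_periodic (a b : ℕ → ZMod 2) (n : ℕ) (ha : ∀ l, a (l+n) = a l) (hb : ∀ l, b (l+n) = b l)
    (h : bor a b n = 0) (l : ℕ) : bor a b (l + n) = bor a b l := by
  induction l with
  | zero => simp [h, bor]
  | succ l ih =>
    rw [show l + 1 + n = (l + n) + 1 by ring]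
    simp only [bor, ha, hb, ih]

open Classical in
/-- the combinatorial decomposition -/
lemma decomp (a b : ℕ → ZMod 2) (n m : ℕ) (ha : ∀ l, a (l+n) = a l) (hb : ∀ l, b (l+n) = b l)
    (h : bor a b n = 0) (hw : ∀ l, ∃ h, h < m ∧ a (l+h) + b (l+h) ≠ 0) :
    ∑ l ∈ Finset.range n, sg (a l + b l + bor a b l)
      = ∑ i ∈ Finset.range m, ∑ l ∈ Finset.range n,
        (if a l + b l = 1 ∧ ∀ h, 0 < h → h < i + 1 → a (l+h) + b (l+h) = 0 then
          sg (a (l+(i+1)) + b (l+(i+1)) + b l) else 0) := by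
  have hp := bor_periodic a b n ha hb h
  set Q : ℕ → ℤ := fun i => ∑ l ∈ Finset.range n,
    (if ∀ h, h < i → a (l+h) + b (l+h) = 0 then
      sg (a (l+i) + b (l+i) + bor a b l) else 0) with hQ
  have hQ0 : Q 0 = ∑ l ∈ Finset.range n, sg (a l + b l + bor a b l) := by
    simp [hQ]
  have hQm : Q m = 0 := by
    apply Finset.sum_eq_zero
    intro l _
    obtain ⟨k, hk, hk'⟩ := hw l
    rw [if_neg]
    intro H; exact hk' (H k hk)
  have step : ∀ i, Q i = Q (i+1) + ∑ l ∈ Finset.range n,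
        (if a l + b l = 1 ∧ ∀ h, 0 < h → h < i + 1 → a (l+h) + b (l+h) = 0 then
          sg (a (l+(i+1)) + b (l+(i+1)) + b l) else 0) := by
    intro i
    simp only [hQ]
    rw [← sum_shift, ← Finset.sum_add_distrib]
    · apply Finset.sum_congr rfl
      intro l _
      have e1 : (∀ h, h < i → a (l+1+h) + b (l+1+h) = 0) ↔
          (∀ h, 0 < h → h < i + 1 → a (l+h) + b (l+h) = 0) := by
        constructor
        · intro H k hk hk'
          have := H (k-1) (by omega)
          rwa [show l + 1 + (k-1) = l + k by omega] at this
        · intro H k hk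
          have := H (k+1) (by omega) (by omega)
          rwa [show l + (k+1) = l + 1 + k by omega] at this
      have e2 : (∀ h, h < i+1 → a (l+h) + b (l+h) = 0) ↔
          a l + b l = 0 ∧ (∀ h, 0 < h → h < i + 1 → a (l+h) + b (l+h) = 0) := by
        constructor
        · intro H
          exact ⟨by simpa using H 0 (by omega), fun k _ hk => H k hk⟩
        · rintro ⟨H0, H⟩ k hk
          rcases Nat.eq_zero_or_pos k with rfl | hk0
          · simpa using H0
          · exact H k hk0 hk
      simp only [e1, e2]
      rw [show l + 1 + i = l + (i+1) by ring]
      by_cases H : (∀ h, 0 < h → h < i + 1 → a (l+h) + b (l+h) = 0)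
      · have H' := iff_true_intro H
        simp only [H', bor, if_true, and_true]
        have key : ∀ x y c z : ZMod 2, sg (z + if x = y then c else y) =
          (if x + y = 0 then sg (z + c) else 0) + (if x + y = 1 then sg (z + y) else 0) := by
          decide
        exact key _ _ _ _
      · simp only [H, and_false, if_false, add_zero]
    · have e : ∀ k, a (n + k) = a (0 + k) := fun k => by rw [add_comm, ha, zero_add]
      have e' : ∀ k, b (n + k) = b (0 + k) := fun k => by rw [add_comm, hb, zero_add]
      have e3 : bor a b n = bor a b 0 := by simp [h, bor]
      simp only [e, e', e3]
  have : ∀ k, Q 0 = Q k + ∑ i ∈ Finset.range k, ∑ l ∈ Finset.range n,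
        (if a l + b l = 1 ∧ ∀ h, 0 < h → h < i + 1 → a (l+h) + b (l+h) = 0 then
          sg (a (l+(i+1)) + b (l+(i+1)) + b l) else 0) := by
    intro k
    induction k with
    | zero => simp
    | succ k ih => rw [ih, step k, Finset.sum_range_succ]; ring
  rw [← hQ0, this m, hQm, zero_add]

lemma basis_exists {K : Type*} [Field K] [Fintype K] [Algebra (ZMod 2) K] (m : ℕ)
    (hK : Module.finrank (ZMod 2) K = m)
    (p : K) (hp : ∀ z : K, z ≠ 0 → ∃ l : ℕ, z = p ^ l) :
    ∃ B : Module.Basis (Fin m) (ZMod 2) K, ∀ i, B i = p ^ (i : ℕ) := by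
  have htop : Algebra.adjoin (ZMod 2) {p} = ⊤ := by
    rw [eq_top_iff]
    intro z _
    by_cases hz : z = 0
    · rw [hz]; exact zero_mem _
    · obtain ⟨l, rfl⟩ := hp z hz
      exact pow_mem (Algebra.subset_adjoin (Set.mem_singleton p)) l
  have hint : IsIntegral (ZMod 2) p := Algebra.IsIntegral.isIntegral p
  obtain ⟨pb, hgen⟩ : ∃ pb : PowerBasis (ZMod 2) K, pb.gen = p :=
    ⟨PowerBasis.ofAdjoinEqTop hint htop, PowerBasis.ofAdjoinEqTop_gen hint htop⟩
  have hd : pb.dim = m := by rw [← hK, pb.finrank]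
  refine ⟨pb.basis.reindex (finCongr hd), fun i => ?_⟩
  simp [hgen]

/-- coordinates by the trace -/
noncomputable def co {K : Type*} [Field K] [Algebra (ZMod 2) K] {m : ℕ}
    (B : Module.Basis (Fin m) (ZMod 2) K) (u : K) : Fin m → ZMod 2 :=
  fun i => Algebra.trace (ZMod 2) K (u * B i)

lemma co_repr {K : Type*} [Field K] [Algebra (ZMod 2) K] {m : ℕ}
    (B : Module.Basis (Fin m) (ZMod 2) K) (u w : K) :
    Algebra.trace (ZMod 2) K (u * w) = ∑ h, B.repr w h * co B u h := by
  conv_lhs => rw [← B.sum_repr w, Finset.mul_sum, map_sum]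
  apply Finset.sum_congr rfl
  intro h _
  rw [mul_smul_comm, map_smul, smul_eq_mul, co]

lemma co_inj {K : Type*} [Field K] [Fintype K] [Algebra (ZMod 2) K] {m : ℕ}
    (B : Module.Basis (Fin m) (ZMod 2) K) (u : K) (hu : co B u = 0) : u = 0 := by
  have h := (traceForm_nondegenerate (ZMod 2) K).1 u
  apply h
  intro w
  rw [Algebra.traceForm_apply, co_repr B, hu]
  simp

lemma co_bij {K : Type*} [Field K] [Fintype K] [Algebra (ZMod 2) K] {m : ℕ}
    (B : Module.Basis (Fin m) (ZMod 2) K) : Function.Bijective (co B) := by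
  rw [Fintype.bijective_iff_injective_and_card]
  constructor
  · intro u v huv
    rw [← sub_eq_zero]
    apply co_inj B
    funext i
    have := congrFun huv i
    simp only [co, sub_mul, map_sub, Pi.zero_apply] at *
    rw [this, sub_self]
  · exact Fintype.card_congr B.equivFun.toEquiv

open Classical in
lemma char_sum {K : Type*} [Field K] [Fintype K] [Algebra (ZMod 2) K] {m : ℕ}
    (B : Module.Basis (Fin m) (ZMod 2) K) (z : Fin m) (hz : (z : ℕ) = 0) (i : ℕ) (hi : 1 ≤ i) (w : K) :
    ∑ u : K, (if co B u z = 1 ∧ ∀ h : Fin m, 0 < (h : ℕ) → (h : ℕ) < i → co B u h = 0 then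
      sg (Algebra.trace (ZMod 2) K (u * w)) else 0)
    = sg (B.repr w z) * ∏ h ∈ Finset.univ.filter (fun h : Fin m => i ≤ (h : ℕ)),
        (if B.repr w h = 0 then 2 else 0) := by
  let g : Fin m → ZMod 2 → ℤ := fun h y =>
    if (h : ℕ) = 0 then (if y = 1 then sg (B.repr w h * y) else 0)
    else if (h : ℕ) < i then (if y = 0 then sg (B.repr w h * y) else 0)
    else sg (B.repr w h * y)
  have h1 : ∀ u : K, (if co B u z = 1 ∧ ∀ h : Fin m, 0 < (h : ℕ) → (h : ℕ) < i → co B u h = 0 then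
      sg (Algebra.trace (ZMod 2) K (u * w)) else 0) = ∏ h, g h (co B u h) := by
    intro u
    split_ifs with H
    · rw [co_repr B, sg_sum]
      apply Finset.prod_congr rfl
      intro h _
      simp only [g]
      split_ifs with c1 c2 c3 c4
      · rfl
      · exact absurd ((show h = z from Fin.ext (by omega)) ▸ H.1) c2
      · rfl
      · exact absurd (H.2 h (by omega) c3) c4
      · rfl
    · symm
      rw [not_and_or] at H
      rcases H with H | H
      · apply Finset.prod_eq_zero (Finset.mem_univ z)
        simp [g, hz, H]
      · push Not at H
        obtain ⟨h, h0, hi', hne⟩ := H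
        apply Finset.prod_eq_zero (Finset.mem_univ h)
        simp only [g]
        rw [if_neg (by omega), if_pos hi', if_neg hne]
  rw [Finset.sum_congr rfl (fun u _ => h1 u)]
  rw [(co_bij B).sum_comp (fun x : Fin m → ZMod 2 => ∏ h, g h (x h))]
  have h2 := Finset.prod_univ_sum (fun _ : Fin m => (Finset.univ : Finset (ZMod 2))) g
  rw [Fintype.piFinset_univ] at h2
  rw [← h2]
  have huniv : ∀ f : ZMod 2 → ℤ, ∑ y, f y = f 0 + f 1 := fun f => Fin.sum_univ_two f
  have h3 : ∀ h, ∑ y, g h y = (if h = z then sg (B.repr w z) else 1) *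
      (if i ≤ (h : ℕ) then (if B.repr w h = 0 then 2 else 0) else 1) := by
    intro h
    rw [huniv]
    simp only [g]
    by_cases c : h = z
    · subst c
      have : ¬ i ≤ (h : ℕ) := by omega
      simp [hz, this]
      intro; omega
    · have c' : (h : ℕ) ≠ 0 := fun c' => c (Fin.ext (by omega))
      by_cases d : (h : ℕ) < i
      · have : ¬ i ≤ (h : ℕ) := by omega
        simp [c, c', d, this, sg_zero]
      · have : i ≤ (h : ℕ) := by omega
        simp only [c, c', d, this, if_false, if_true]
        generalize B.repr w h = r
        revert r; decide
  rw [Finset.prod_congr rfl (fun h _ => h3 h), Finset.prod_mul_distrib, Finset.prod_filter]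
  simp

lemma repr_pow_zero {K : Type*} [Field K] [Algebra (ZMod 2) K] {m : ℕ}
    (B : Module.Basis (Fin m) (ZMod 2) K) (p : K) (hp : p ≠ 0) (hB : ∀ i, B i = p ^ (i : ℕ))
    (z : Fin m) (hz : (z : ℕ) = 0) : B.repr (p ^ m) z = 1 := by
  by_contra hne
  have h0 : B.repr (p ^ m) z = 0 := by
    generalize B.repr (p ^ m) z = r at *
    revert r; decide
  obtain ⟨k, rfl⟩ : ∃ k, m = k + 1 := ⟨m - 1, by have := z.2; omega⟩
  have hz' : z = 0 := Fin.ext (by simpa using hz)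
  subst hz'
  have h1 := B.sum_repr (p ^ (k+1))
  rw [Fin.sum_univ_succ, h0, zero_smul, zero_add] at h1
  have h2 : p ^ k = ∑ i : Fin k, B.repr (p ^ (k+1)) i.succ • B i.castSucc := by
    apply mul_left_cancel₀ hp
    rw [← pow_succ', Finset.mul_sum]
    conv_lhs => rw [← h1]
    apply Finset.sum_congr rfl
    intro i _
    rw [hB, hB, mul_smul_comm]
    congr 1
    simp [pow_succ']
  have h3 : p ^ k = B (Fin.last k) := by rw [hB]; simp
  rw [h3] at h2
  have h4 := congrArg (fun x => B.repr x (Fin.last k)) h2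
  simp only [map_sum, map_smul, Module.Basis.repr_self, Finsupp.coe_finsetSum,
    Finset.sum_apply, Finsupp.smul_apply] at h4
  rw [Finset.sum_eq_zero] at h4
  · simp at h4
  · intro i _
    rw [Finsupp.single_eq_of_ne]
    · simp
    · exact (Fin.castSucc_lt_last i).ne'

lemma final_sum {K : Type*} [Field K] [Algebra (ZMod 2) K] {m : ℕ}
    (B : Module.Basis (Fin m) (ZMod 2) K) (p : K) (hp : p ≠ 0) (hB : ∀ i, B i = p ^ (i : ℕ))
    (z : Fin m) (hz : (z : ℕ) = 0) (e : K) (he0 : e ≠ 0) (he1 : e ≠ 1) :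
    ∃ k, 1 ≤ k ∧ k ≤ m - 1 ∧
      ∑ i ∈ Finset.range m, (sg (B.repr (p ^ (i+1) + e) z) *
        ∏ h ∈ Finset.univ.filter (fun h : Fin m => i + 1 ≤ (h : ℕ)),
        (if B.repr (p ^ (i+1) + e) h = 0 then (2:ℤ) else 0)) = sg (B.repr e z) * (2 ^ k - 1) := by
  classical
  obtain ⟨M, rfl⟩ : ∃ k, m = k + 1 := ⟨m - 1, by have := z.2; omega⟩
  have hBz : B z = 1 := by rw [hB, hz, pow_zero]
  -- the degree of e
  have hex : ∃ h : Fin (M+1), h ≠ z ∧ B.repr e h ≠ 0 := by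
    by_contra H
    push Not at H
    have h1 := B.sum_repr e
    rw [Finset.sum_eq_single z (fun h _ hh => by rw [H h hh, zero_smul]) (by simp), hBz] at h1
    have : ∀ r : ZMod 2, r = 0 ∨ r = 1 := by decide
    rcases this (B.repr e z) with h | h <;> rw [h] at h1
    · simp at h1; exact he0 h1.symm
    · simp at h1; exact he1 h1.symm
  let S := Finset.univ.filter (fun h : Fin (M+1) => B.repr e h ≠ 0)
  have hS : S.Nonempty := by obtain ⟨h, _, hh⟩ := hex; exact ⟨h, by simp [S, hh]⟩
  let D := S.max' hS
  have hDmem : B.repr e D ≠ 0 := by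
    have := S.max'_mem hS
    simpa [S] using this
  have hDmax : ∀ h, B.repr e h ≠ 0 → h ≤ D := fun h hh => S.le_max' h (by simp [S, hh])
  have hD0 : (D : ℕ) ≠ 0 := by
    obtain ⟨h, h1, h2⟩ := hex
    have := hDmax h h2
    intro h3
    apply h1
    apply Fin.ext
    have : (h : ℕ) ≤ D := this
    omega
  have hr : ∀ i (hi : i + 1 < M + 1) h, B.repr (p ^ (i+1) + e) h
      = (if (h : ℕ) = i + 1 then 1 else 0) + B.repr e h := by
    intro i hi h
    have : p ^ (i+1) = B ⟨i+1, hi⟩ := by rw [hB]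
    rw [this, map_add, Module.Basis.repr_self, Finsupp.add_apply, Finsupp.single_apply]
    congr 1
    simp [Fin.ext_iff, eq_comm]
  have h2 : ∀ r : ZMod 2, r ≠ 0 → r = 1 := by decide
  refine ⟨M + 1 - D, by have := D.2; omega, by omega, ?_⟩
  rw [Finset.sum_range_succ]
  have hlast : sg (B.repr (p ^ (M+1) + e) z) *
        ∏ h ∈ Finset.univ.filter (fun h : Fin (M+1) => M + 1 ≤ (h : ℕ)),
        (if B.repr (p ^ (M+1) + e) h = 0 then (2:ℤ) else 0) = - sg (B.repr e z) := by
    rw [Finset.filter_false_of_mem (fun h _ => by have := h.2; omega), Finset.prod_empty,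
      map_add, Finsupp.add_apply, repr_pow_zero B p hp hB z hz, sg_add]
    have : sg 1 = -1 := by decide
    rw [this]; ring
  rw [hlast]
  have hDM : (D : ℕ) - 1 ∈ Finset.range M := by have := D.2; simp; omega
  rw [Finset.sum_eq_single_of_mem _ hDM]
  · have hD1 : (D : ℕ) - 1 + 1 = D := by omega
    have hD2 : (D : ℕ) - 1 + 1 < M + 1 := by have := D.2; omega
    rw [hr _ hD2, if_neg (by omega), zero_add]
    rw [Finset.prod_congr rfl (g := fun _ => (2:ℤ))]
    · rw [Finset.prod_const]
      have : (Finset.univ.filter (fun h : Fin (M+1) => (D:ℕ) - 1 + 1 ≤ (h : ℕ))) = Finset.Ici D := by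
        ext h; rw [hD1, Finset.mem_filter, Finset.mem_Ici, Fin.le_def]; simp only [Finset.mem_univ, true_and]
      rw [this, Fin.card_Ici]
      ring
    · intro h hh
      rw [Finset.mem_filter] at hh
      rw [hr _ hD2, if_pos]
      by_cases c : h = D
      · subst c
        rw [if_pos (by omega), h2 _ hDmem]; decide
      · have c' : (h : ℕ) ≠ D := fun c' => c (Fin.ext c')
        rw [if_neg (by omega), zero_add]
        by_contra H
        have : (h : ℕ) ≤ D := hDmax h H
        omega
  · intro i hi hne
    have hi' : i + 1 < M + 1 := by simpa using hi
    rw [mul_eq_zero]; right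
    rcases lt_or_gt_of_ne (show i + 1 ≠ (D : ℕ) by omega) with c | c
    · apply Finset.prod_eq_zero (i := D) (by simp; omega)
      rw [hr _ hi', if_neg (by omega : ¬ (D:ℕ) = i + 1), zero_add, if_neg hDmem]
    · apply Finset.prod_eq_zero (i := ⟨i+1, hi'⟩) (by simp)
      rw [hr _ hi', if_pos rfl]
      have : B.repr e ⟨i+1, hi'⟩ = 0 := by
        by_contra H
        have : i + 1 ≤ (D : ℕ) := hDmax _ H
        omega
      rw [this]; simp

lemma sum_pow_range {K : Type*} [Field K] [Fintype K] (n : ℕ) (hn : Fintype.card K = n + 1)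
    (p : K) (hp : p ≠ 0) (ho : orderOf p = n) (v : K) (hv : v ≠ 0) (F : K → ℤ) (hF : F 0 = 0) :
    ∑ l ∈ Finset.range n, F (v * p ^ l) = ∑ u, F u := by
  classical
  have hinj : Set.InjOn (fun l => v * p ^ l) ((Finset.range n : Finset ℕ) : Set ℕ) := by
    intro x hx y hy hxy
    have := mul_left_cancel₀ hv hxy
    exact pow_injOn_Iio_orderOf (by simpa [ho] using hx) (by simpa [ho] using hy) this
  have him : (Finset.range n).image (fun l => v * p ^ l) = Finset.univ.erase 0 := by
    apply Finset.eq_of_subset_of_card_le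
    · intro x hx
      rw [Finset.mem_image] at hx
      obtain ⟨l, _, rfl⟩ := hx
      simp [hv, hp]
    · rw [Finset.card_image_of_injOn hinj, Finset.card_erase_of_mem (Finset.mem_univ _),
        Finset.card_univ, hn]
      simp
  rw [← Finset.sum_image (g := fun l => v * p ^ l) (f := F) hinj, him,
    Finset.sum_erase _ hF]

lemma core {K : Type*} [Field K] [Fintype K] [Algebra (ZMod 2) K] (m n : ℕ) (hm : 2 ≤ m)
    (hK : Module.finrank (ZMod 2) K = m) (hn : Fintype.card K = n + 1) (p : K) (ho : orderOf p = n)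
    (hp : p ≠ 0) (x y : K) (hx : x ≠ 0) (hy : y ≠ 0) (hxy : x + y ≠ 0) (a b : ℕ → ZMod 2)
    (ha : ∀ l, a l = Algebra.trace (ZMod 2) K (x * p ^ l))
    (hb : ∀ l, b l = Algebra.trace (ZMod 2) K (y * p ^ l))
    (h : sigma n (fun l => (b l).val) ≤ sigma n (fun l => (a l).val)) :
    ∃ k, 1 ≤ k ∧ k ≤ m - 1 ∧
    (2 * (w2 (sigma n (fun l => (a l).val) - sigma n (fun l => (b l).val)) : ℤ) - n = 2 ^ k - 1 ∨
     2 * (w2 (sigma n (fun l => (a l).val) - sigma n (fun l => (b l).val)) : ℤ) - n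
      = - (2 ^ k - 1)) := by
  classical
  have hgen : ∀ z : K, z ≠ 0 → ∃ l : ℕ, z = p ^ l := by
    intro z hz
    by_contra H
    push Not at H
    have := sum_pow_range n hn p hp ho 1 one_ne_zero (fun u => if u = z then 1 else 0)
      (by simp [hz.symm])
    rw [Finset.sum_eq_zero] at this
    · simp at this
    · intro l _
      rw [one_mul, if_neg (H l).symm]
  obtain ⟨B, hB⟩ := basis_exists m hK p hgen
  have hpn : p ^ n = 1 := by rw [← ho]; exact pow_orderOf_eq_one p
  have hap : ∀ l, a (l+n) = a l := fun l => by rw [ha, ha, pow_add, hpn, mul_one]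
  have hbp : ∀ l, b (l+n) = b l := fun l => by rw [hb, hb, pow_add, hpn, mul_one]
  have hco : ∀ l (h : Fin m), a (l + h) + b (l + h) = co B ((x+y) * p ^ l) h := by
    intro l h
    rw [ha, hb, ← map_add, co, hB]
    congr 1
    ring
  have hw : ∀ l, ∃ h, h < m ∧ a (l+h) + b (l+h) ≠ 0 := by
    intro l
    by_contra H
    push Not at H
    have := co_inj B ((x+y) * p ^ l) (by
      funext h
      rw [← hco, H h h.2]; rfl)
    simp [hxy, hp] at this
  rw [w2_diff a b n h, decomp a b n m hap hbp (bor_end a b n h) hw]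
  let z : Fin m := ⟨0, by omega⟩
  let e : K := y / (x + y)
  have he0 : e ≠ 0 := div_ne_zero hy hxy
  have he1 : e ≠ 1 := by
    intro H
    rw [div_eq_one_iff_eq hxy] at H
    exact hx (by simpa using H)
  obtain ⟨k, hk1, hk2, hk⟩ := final_sum B p hp hB z rfl e he0 he1
  have hmain : ∀ i ∈ Finset.range m, ∑ l ∈ Finset.range n,
        (if a l + b l = 1 ∧ ∀ h, 0 < h → h < i + 1 → a (l+h) + b (l+h) = 0 then
          sg (a (l+(i+1)) + b (l+(i+1)) + b l) else 0)
      = sg (B.repr (p ^ (i+1) + e) z) *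
        ∏ h ∈ Finset.univ.filter (fun h : Fin m => i + 1 ≤ (h : ℕ)),
        (if B.repr (p ^ (i+1) + e) h = 0 then (2:ℤ) else 0) := by
    intro i hi
    have hi' : i < m := by simpa using hi
    rw [← char_sum B z rfl (i+1) (by omega), ← sum_pow_range n hn p hp ho (x+y) hxy]
    · apply Finset.sum_congr rfl
      intro l _
      have c1 : a l + b l = co B ((x+y) * p ^ l) z := by rw [← hco]; rfl
      have c2 : (∀ h, 0 < h → h < i + 1 → a (l+h) + b (l+h) = 0) ↔
          ∀ h : Fin m, 0 < (h : ℕ) → (h : ℕ) < i + 1 → co B ((x+y) * p ^ l) h = 0 := by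
        constructor
        · intro H h h0 h1
          rw [← hco]; exact H h h0 h1
        · intro H h h0 h1
          have := H ⟨h, by omega⟩ h0 h1
          rwa [← hco] at this
      have c3 : a (l+(i+1)) + b (l+(i+1)) + b l
          = Algebra.trace (ZMod 2) K ((x+y) * p ^ l * (p ^ (i+1) + e)) := by
        rw [ha, hb, hb, ← map_add, ← map_add]
        congr 1
        have : (x + y) * e = y := mul_div_cancel₀ _ hxy
        linear_combination (- p ^ l) * this
      simp only [c1, c2, c3]
    · rw [if_neg]
      rintro ⟨H, _⟩
      simp [co] at H
  rw [Finset.sum_congr rfl hmain, hk]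
  refine ⟨k, hk1, hk2, ?_⟩
  have : ∀ r : ZMod 2, sg r = 1 ∨ sg r = -1 := by decide
  rcases this (B.repr e z) with c | c <;> rw [c]
  · right; ring
  · left; ring

theorem mseq_arithAC_values (m : ℕ) (hm : 2 ≤ m)
    (π : GaloisField 2 m) (hπ : orderOf π = 2 ^ m - 1)
    (s : ℕ → ZMod 2)
    (hs : ∀ l, s l = Algebra.trace (ZMod 2) (GaloisField 2 m) (π ^ l))
    (τ : ℕ) (hτ1 : 1 ≤ τ) (hτ2 : τ ≤ 2 ^ m - 2) :
    arithAC (2 ^ m - 1) (fun l => (s l).val) τ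
      ∈ {A : ℤ | ∃ k, 1 ≤ k ∧ k ≤ m - 1 ∧ (A = 2 ^ k - 1 ∨ A = -(2 ^ k - 1))} := by
  have : Fintype (GaloisField 2 m) := Fintype.ofFinite _
  have hpos : 2 ^ 2 ≤ 2 ^ m := Nat.pow_le_pow_right (by norm_num) hm
  have hcard : Fintype.card (GaloisField 2 m) = (2 ^ m - 1) + 1 := by
    rw [← Nat.card_eq_fintype_card, GaloisField.card 2 m (by omega)]; omega
  have hfin : Module.finrank (ZMod 2) (GaloisField 2 m) = m := GaloisField.finrank 2 (by omega)
  have hp : π ≠ 0 := by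
    rintro rfl
    rw [orderOf_zero] at hπ
    omega
  have hc : π ^ τ ≠ 0 := pow_ne_zero _ hp
  have hc1 : π ^ τ ≠ 1 := pow_ne_one_of_lt_orderOf (by omega) (by omega)
  have hsum : 1 + π ^ τ ≠ 0 := by
    intro H
    rw [CharTwo.add_eq_zero] at H
    exact hc1 H.symm
  have ha : ∀ l, s l = Algebra.trace (ZMod 2) (GaloisField 2 m) (1 * π ^ l) := by
    intro l; rw [one_mul, hs]
  have hb : ∀ l, s (l + τ) = Algebra.trace (ZMod 2) (GaloisField 2 m) (π ^ τ * π ^ l) := by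
    intro l; rw [hs, pow_add, mul_comm]
  rw [Set.mem_ofPred_eq]
  unfold arithAC
  split_ifs with h
  · exact core m (2 ^ m - 1) hm hfin hcard π hπ hp 1 (π ^ τ) one_ne_zero hc hsum s
      (fun l => s (l + τ)) ha hb h.le
  · obtain ⟨k, h1, h2, h3⟩ := core m (2 ^ m - 1) hm hfin hcard π hπ hp (π ^ τ) 1 hc one_ne_zero
      (by rwa [add_comm]) (fun l => s (l + τ)) s hb ha (not_lt.mp h)
    refine ⟨k, h1, h2, ?_⟩
    rcases h3 with h3 | h3
    · right; rw [← h3]; ring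
    · left; rw [← neg_eq_iff_eq_neg] at h3; rw [← h3]; ring
end

section
/- Let s be the binary m-sequence s_λ = T(π^λ) of period n = 2^m - 1 (m ≥ 2). For each 1 ≤ k ≤ m-1 and each sign ε ∈ {+1, -1}, the number of shifts τ with 1 ≤ τ ≤ n-1 such that A_s(τ) = ε(2^k - 1) is exactly 2^{m-k-1}. Consequently, for each 1 ≤ k ≤ m-1, the number of τ with |A_s(τ)| = 2^k - 1 is 2^{m-k}. -/
lemma w2_sum (n : ℕ) : ∀ d : ℕ → ℕ, (∀ l, d l ≤ 1) →
    w2 (∑ l ∈ Finset.range n, d l * 2 ^ l) = ∑ l ∈ Finset.range n, d l := by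
  induction n with
  | zero => intro d _; simp [w2]
  | succ n ih =>
    intro d hd
    have h := ih (fun l => d (l + 1)) (fun l => hd _)
    rw [Finset.sum_range_succ', Finset.sum_range_succ' d, ← h]
    have e : ∑ k ∈ Finset.range n, d (k + 1) * 2 ^ (k + 1) + d 0 * 2 ^ 0
        = d 0 + 2 * ∑ l ∈ Finset.range n, d (l + 1) * 2 ^ l := by
      rw [Finset.mul_sum, add_comm]
      simp only [pow_zero, mul_one]
      congr 1
      apply Finset.sum_congr rfl
      intros; ring
    rw [e]
    generalize ∑ l ∈ Finset.range n, d (l + 1) * 2 ^ l = M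
    have h0 := hd 0
    unfold w2
    by_cases hz : d 0 + 2 * M = 0
    · have : d 0 = 0 := by omega
      have : M = 0 := by omega
      simp [*]
    · rw [Nat.digits_def' (by norm_num) (by omega)]
      have e1 : (d 0 + 2 * M) % 2 = d 0 := by omega
      have e2 : (d 0 + 2 * M) / 2 = M := by omega
      rw [e1, e2]
      simp [add_comm]

lemma arithAC_eq (n τ : ℕ) (a : ℕ → ℕ) (ha : ∀ l, a l ≤ 1) (g : ℕ → ℤ)
    (hg : ∀ l, g l = 1 ∨ g l = -1)
    (hrec : ∀ l, g (l + 1) = if a l = a (l + τ) then g l else 1 - 2 * (a l : ℤ))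
    (hper : g n = g 0)
    (hsum : ∑ l ∈ Finset.range n, a l = ∑ l ∈ Finset.range n, a (l + τ))
    (hne : ∃ l < n, a l ≠ a (l + τ)) :
    arithAC n a τ = ∑ l ∈ Finset.range n, g l := by
  -- difference digits
  have hd : ∀ l, ∃ d : ℕ, d ≤ 1 ∧
      2 * (d : ℤ) = 2 * a l - 2 * a (l + τ) - (1 + g l) + 2 * (1 + g (l + 1)) ∧
      (d = 0 → g l = -1 → a l = a (l + τ)) := by
    intro l
    have h1 := ha l
    have h2 := ha (l + τ)
    have h3 := hrec l
    split_ifs at h3 with h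
    · rcases hg l with h4 | h4
      · exact ⟨1, by omega, by push_cast; omega, by omega⟩
      · exact ⟨0, by omega, by push_cast; omega, by omega⟩
    · rcases hg l with h4 | h4
      · exact ⟨0, by omega, by push_cast; omega, by omega⟩
      · exact ⟨1, by omega, by push_cast; omega, by omega⟩
  choose d hd1 hd2 hd3 using hd
  have key : ∀ N, 2 * ∑ l ∈ Finset.range N, (d l : ℤ) * 2 ^ l
      = 2 * ∑ l ∈ Finset.range N, (a l : ℤ) * 2 ^ l
        - 2 * ∑ l ∈ Finset.range N, (a (l + τ) : ℤ) * 2 ^ l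
        + (1 + g N) * 2 ^ N - (1 + g 0) := by
    intro N
    induction N with
    | zero => simp
    | succ N ih =>
      simp only [Finset.sum_range_succ]
      have := hd2 N
      rw [pow_succ]
      linear_combination ih + 2 ^ N * this
  have key2 : ∀ N, 2 * ∑ l ∈ Finset.range N, (d l : ℤ)
      = 2 * ∑ l ∈ Finset.range N, (a l : ℤ)
        - 2 * ∑ l ∈ Finset.range N, (a (l + τ) : ℤ)
        + ∑ l ∈ Finset.range N, g l + N + 2 * (g N - g 0) := by
    intro N
    induction N with
    | zero => simp
    | succ N ih =>
      simp only [Finset.sum_range_succ]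
      have := hd2 N
      push_cast
      linear_combination ih + this
  have k1 := key n
  have k2 := key2 n
  have hsum' : ∑ l ∈ Finset.range n, (a l : ℤ) = ∑ l ∈ Finset.range n, (a (l + τ) : ℤ) := by
    exact_mod_cast hsum
  rw [hper] at k1 k2
  have hs1 : (sigma n a : ℤ) = ∑ l ∈ Finset.range n, (a l : ℤ) * 2 ^ l := by
    simp [sigma]
  have hs2 : (sigma n (fun l => a (l + τ)) : ℤ)
      = ∑ l ∈ Finset.range n, (a (l + τ) : ℤ) * 2 ^ l := by
    simp [sigma]
  rw [← hs1, ← hs2] at k1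
  have hw := w2_sum n d hd1
  have hdc : ((∑ l ∈ Finset.range n, d l * 2 ^ l : ℕ) : ℤ)
     = ∑ l ∈ Finset.range n, (d l : ℤ) * 2 ^ l := by push_cast; rfl
  have hdc2 : ((∑ l ∈ Finset.range n, d l : ℕ) : ℤ)
     = ∑ l ∈ Finset.range n, (d l : ℤ) := by push_cast; rfl
  rw [← hdc] at k1
  rw [← hdc2] at k2
  unfold arithAC
  rcases hg 0 with h0 | h0
  · have hw' := w2_sum n (fun l => 1 - d l) (fun l => by omega)
    have geo : ∑ l ∈ Finset.range n, (2 : ℤ) ^ l = 2 ^ n - 1 := by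
      have := mul_geom_sum (2 : ℤ) n
      linarith
    have e1 : ((∑ l ∈ Finset.range n, (1 - d l) * 2 ^ l : ℕ) : ℤ)
        = 2 ^ n - 1 - (∑ l ∈ Finset.range n, d l * 2 ^ l : ℕ) := by
      rw [hdc, ← geo, ← Finset.sum_sub_distrib]
      push_cast
      apply Finset.sum_congr rfl
      intro l _
      rw [Nat.cast_sub (hd1 l)]; push_cast; ring
    have e2 : ((∑ l ∈ Finset.range n, (1 - d l) : ℕ) : ℤ)
        = n - (∑ l ∈ Finset.range n, d l : ℕ) := by
      have : (n : ℤ) = ∑ l ∈ Finset.range n, (1 : ℤ) := by simp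
      rw [hdc2, this, ← Finset.sum_sub_distrib]
      push_cast
      apply Finset.sum_congr rfl
      intro l _
      rw [Nat.cast_sub (hd1 l)]; push_cast; ring
    rw [h0] at k1
    have : sigma n (fun l => a (l + τ)) - sigma n a
       = ∑ l ∈ Finset.range n, (1 - d l) * 2 ^ l := by
      zify [show sigma n a ≤ sigma n (fun l => a (l + τ)) by omega]
      push_cast at e1 ⊢
      linarith
    rw [if_neg (by omega), this, hw', e2]
    linarith
  · rw [h0] at k1
    have : sigma n a - sigma n (fun l => a (l + τ))
       = ∑ l ∈ Finset.range n, d l * 2 ^ l := by omega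
    have hpos : sigma n a > sigma n (fun l => a (l + τ)) := by
      by_contra hcon
      have hz : ∑ l ∈ Finset.range n, d l * 2 ^ l = 0 := by omega
      rw [Finset.sum_eq_zero_iff] at hz
      have hz' : ∀ l < n, d l = 0 := by
        intro l hl
        have := hz l (by simpa using hl)
        simpa using this
      have hgm : ∀ l ≤ n, g l = -1 := by
        intro l
        induction l with
        | zero => intro _; exact h0
        | succ l ih =>
          intro hl
          have i1 := ih (by omega)
          rw [hrec l, if_pos (hd3 l (hz' l (by omega)) i1), i1]
      obtain ⟨l, hl, hl'⟩ := hne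
      exact hl' (hd3 l (hz' l hl) (hgm l hl.le))
    rw [if_pos hpos, this, hw]
    linarith

section field
set_option linter.unusedSectionVars false
variable {F : Type*} [Field F] [Algebra (ZMod 2) F] [Fintype F]

/-- the additive character of `ZMod 2` -/
def chi2 (z : ZMod 2) : ℤ := 1 - 2 * (z.val : ℤ)

lemma chi2_zero : chi2 0 = 1 := by decide
lemma chi2_one : chi2 1 = -1 := by decide
lemma chi2_add : ∀ a b : ZMod 2, chi2 (a + b) = chi2 a * chi2 b := by decide
lemma zmod2_cases : ∀ a : ZMod 2, a = 0 ∨ a = 1 := by decide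

lemma chi2_sum {ι : Type*} (t : Finset ι) (f : ι → ZMod 2) :
    chi2 (∑ i ∈ t, f i) = ∏ i ∈ t, chi2 (f i) := by
  classical
  induction t using Finset.induction_on with
  | empty => simp [chi2_zero]
  | insert a t ha ih => rw [Finset.sum_insert ha, Finset.prod_insert ha, chi2_add, ih]

lemma image_pow (π : F) (n : ℕ) (hc : Fintype.card F = n + 1) (hπ : orderOf π = n)
    [DecidableEq F] (hn : 0 < n) :
    (Finset.range n).image (fun l => π ^ l) = Finset.univ.erase 0 := by
  have h0 : π ≠ 0 := by
    rintro rfl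
    have : orderOf (0 : F) = 0 := by
      rw [orderOf_eq_zero_iff']
      intro k hk
      rw [zero_pow hk.ne']; exact zero_ne_one
    omega
  apply Finset.eq_of_subset_of_card_le
  · intro x hx
    simp only [Finset.mem_image, Finset.mem_range] at hx
    obtain ⟨l, _, rfl⟩ := hx
    simp [h0]
  · rw [Finset.card_erase_of_mem (Finset.mem_univ _), Finset.card_univ, hc,
      Finset.card_image_of_injOn, Finset.card_range]
    · simp
    · intro a ha b hb hab
      apply pow_injOn_Iio_orderOf (x := π) _ _ hab
      · simpa [hπ] using ha
      · simpa [hπ] using hb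

lemma sum_pow (π : F) (n : ℕ) (hc : Fintype.card F = n + 1) (hπ : orderOf π = n)
    (hn : 0 < n) (f : F → ℤ) (hf : f 0 = 0) :
    ∑ l ∈ Finset.range n, f (π ^ l) = ∑ x, f x := by
  classical
  rw [← Finset.sum_erase Finset.univ hf, ← image_pow π n hc hπ hn, Finset.sum_image]
  intro a ha b hb hab
  apply pow_injOn_Iio_orderOf (x := π) _ _ hab
  · simpa [hπ] using ha
  · simpa [hπ] using hb

lemma exists_pow (π : F) (n : ℕ) (hc : Fintype.card F = n + 1) (hπ : orderOf π = n)
    (hn : 0 < n) (x : F) (hx : x ≠ 0) : ∃ l < n, π ^ l = x := by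
  classical
  have : x ∈ (Finset.range n).image (fun l => π ^ l) := by
    rw [image_pow π n hc hπ hn]; simp [hx]
  simpa using this

lemma exists_basis (π : F) (m n : ℕ) (hc : Fintype.card F = n + 1) (hπ : orderOf π = n)
    (hn : 0 < n) (hfr : Module.finrank (ZMod 2) F = m) :
    ∃ B : Module.Basis (Fin m) (ZMod 2) F, ∀ e, B e = π ^ (e : ℕ) := by
  have hint : IsIntegral (ZMod 2) π := IsIntegral.of_finite _ _
  have htop : Algebra.adjoin (ZMod 2) {π} = ⊤ := by
    rw [eq_top_iff]
    intro x _
    by_cases hx : x = 0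
    · rw [hx]; exact zero_mem _
    · obtain ⟨l, _, rfl⟩ := exists_pow π n hc hπ hn x hx
      exact pow_mem (Algebra.self_mem_adjoin_singleton _ _) _
  obtain ⟨pb, hgen⟩ : ∃ pb : PowerBasis (ZMod 2) F, pb.gen = π :=
    ⟨PowerBasis.ofAdjoinEqTop hint htop, PowerBasis.ofAdjoinEqTop_gen hint htop⟩
  have hdim : pb.dim = m := by rw [← hfr, pb.finrank]
  refine ⟨pb.basis.reindex (finCongr hdim), fun e => ?_⟩
  simp [hgen]

lemma tr_nondeg (π β : F) (hβ : β ≠ 0) (m : ℕ) (B : Module.Basis (Fin m) (ZMod 2) F)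
    (hB : ∀ e, B e = π ^ (e : ℕ)) (y : F)
    (h : ∀ e < m, Algebra.trace (ZMod 2) F (β * π ^ e * y) = 0) : y = 0 := by
  have h1 : ∀ z, Algebra.trace (ZMod 2) F (z * (β * y)) = 0 := by
    intro z
    have : (Algebra.trace (ZMod 2) F).comp (LinearMap.mulRight (ZMod 2) (β * y)) = 0 := by
      apply B.ext
      intro e
      have := h e e.2
      simp only [LinearMap.comp_apply, LinearMap.mulRight_apply, hB, LinearMap.zero_apply]
      rw [← this]; congr 1; ring
    exact LinearMap.congr_fun this z
  have hnd := traceForm_nondegenerate (ZMod 2) F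
  have h2 : β * y = 0 := by
    exact hnd.1 (β * y) (fun w => by
      rw [Algebra.traceForm_apply, mul_comm]; exact h1 w)
  exact (mul_eq_zero.mp h2).resolve_left hβ

open Classical in
/-- one term of the cyclic carry function -/
noncomputable def qterm (π β : F) (i : ℕ) (y : F) : ℤ :=
  if Algebra.trace (ZMod 2) F (β * y) = 1 ∧
      ∀ k, 1 ≤ k → k < i → Algebra.trace (ZMod 2) F (β * π ^ k * y) = 0 then
    chi2 (Algebra.trace (ZMod 2) F y) else 0

/-- the cyclic carry function -/
noncomputable def gfun (π β : F) (m : ℕ) (x : F) : ℤ :=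
  ∑ i ∈ Finset.range m, qterm π β (i + 1) ((π ^ (i + 1))⁻¹ * x)

lemma gfun_zero (π β : F) (m : ℕ) : gfun π β m 0 = 0 := by
  simp [gfun, qterm]

lemma gfun_rec (π β : F) (hπ : π ≠ 0) (hβ : β ≠ 0) (m : ℕ) (hm : 0 < m)
    (B : Module.Basis (Fin m) (ZMod 2) F) (hB : ∀ e, B e = π ^ (e : ℕ)) (x : F) :
    gfun π β m (π * x) = if Algebra.trace (ZMod 2) F (β * x) = 1 then
      chi2 (Algebra.trace (ZMod 2) F x) else gfun π β m x := by
  obtain ⟨m, rfl⟩ : ∃ m', m = m' + 1 := ⟨m - 1, by omega⟩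
  have e0 : ∀ i, (π ^ (i + 1))⁻¹ * (π * x) = (π ^ i)⁻¹ * x := by
    intro i; field_simp; ring
  have e1 : ∀ i, β * π ^ i * ((π ^ i)⁻¹ * x) = β * x := by
    intro i; field_simp
  have hz : ∀ i, Algebra.trace (ZMod 2) F (β * x) = 1 →
      qterm π β (i + 1 + 1) ((π ^ (i + 1))⁻¹ * x) = 0 := by
    intro i h
    unfold qterm
    rw [if_neg]
    rintro ⟨_, h2⟩
    have := h2 (i + 1) (by omega) (by omega)
    rw [e1, h] at this
    exact one_ne_zero this
  have hs : ∀ i, Algebra.trace (ZMod 2) F (β * x) = 0 →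
      qterm π β (i + 1 + 1) ((π ^ (i + 1))⁻¹ * x) = qterm π β (i + 1) ((π ^ (i + 1))⁻¹ * x) := by
    intro i h
    unfold qterm
    congr 1
    apply propext
    constructor
    · rintro ⟨h1, h2⟩
      exact ⟨h1, fun k hk hk' => h2 k hk (by omega)⟩
    · rintro ⟨h1, h2⟩
      refine ⟨h1, fun k hk hk' => ?_⟩
      by_cases hki : k = i + 1
      · rw [hki, e1, h]
      · exact h2 k hk (by omega)
  unfold gfun
  simp only [e0]
  rw [Finset.sum_range_succ']
  split_ifs with h
  · rw [Finset.sum_eq_zero (fun i _ => hz i h)]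
    simp only [pow_zero, inv_one, one_mul, zero_add]
    unfold qterm
    rw [if_pos ⟨h, fun k hk hk' => by omega⟩]
  · have h' := (zmod2_cases _).resolve_right h
    rw [Finset.sum_congr rfl (fun i _ => hs i h'), Finset.sum_range_succ]
    congr 1
    have r1 : qterm π β (0 + 1) ((π ^ 0)⁻¹ * x) = 0 := by
      unfold qterm
      rw [if_neg]
      rintro ⟨h1, _⟩
      simp only [pow_zero, inv_one, one_mul] at h1
      exact h h1
    rw [r1]
    unfold qterm
    rw [if_neg]
    rintro ⟨h1, h2⟩
    have : π * ((π ^ (m + 1))⁻¹ * x) = 0 := by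
      apply tr_nondeg π β hβ (m + 1) B hB
      intro e he
      rw [show β * π ^ e * (π * ((π ^ (m + 1))⁻¹ * x))
        = β * π ^ (e + 1) * ((π ^ (m + 1))⁻¹ * x) by ring]
      by_cases hem : e = m
      · rw [hem, e1, h']
      · exact h2 _ (by omega) (by omega)
    have := (mul_eq_zero.mp this).resolve_left hπ
    rw [this, mul_zero, map_zero] at h1
    exact zero_ne_one h1

lemma card_eq (m : ℕ) (B : Module.Basis (Fin m) (ZMod 2) F) : 
    Fintype.card F = Fintype.card (Fin m → ZMod 2) := by
  exact Fintype.card_congr B.equivFun.toEquiv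

lemma phi_bij (π β : F) (hβ : β ≠ 0) (m : ℕ)
    (B : Module.Basis (Fin m) (ZMod 2) F) (hB : ∀ e, B e = π ^ (e : ℕ)) :
    Function.Bijective (fun (y : F) (e : Fin m) =>
      Algebra.trace (ZMod 2) F (β * π ^ (e : ℕ) * y)) := by
  rw [Fintype.bijective_iff_injective_and_card]
  refine ⟨?_, card_eq m B⟩
  intro y z hyz
  rw [← sub_eq_zero]
  apply tr_nondeg π β hβ m B hB
  intro e he
  have := congrFun hyz ⟨e, he⟩
  simp only at this
  rw [mul_sub, map_sub, this, sub_self]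

lemma sum_qterm (π β : F) (hβ : β ≠ 0) (m : ℕ) (hm : 0 < m)
    (B : Module.Basis (Fin m) (ZMod 2) F) (hB : ∀ e, B e = π ^ (e : ℕ))
    (c : Fin m → ZMod 2) (hc : β⁻¹ = ∑ e, c e • B e) (i : ℕ) (hi : 1 ≤ i) (him : i ≤ m) :
    ∑ y, qterm π β i y = chi2 (c ⟨0, hm⟩) *
      if ∀ e : Fin m, i ≤ (e : ℕ) → c e = 0 then 2 ^ (m - i) else 0 := by
  classical
  let f : Fin m → ZMod 2 → ℤ := fun e v =>
    (if (e : ℕ) = 0 then (if v = 1 then 1 else 0)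
      else if (e : ℕ) < i then (if v = 0 then 1 else 0) else 1) * chi2 (c e * v)
  have htr : ∀ y, Algebra.trace (ZMod 2) F y
      = ∑ e : Fin m, c e * Algebra.trace (ZMod 2) F (β * π ^ (e : ℕ) * y) := by
    intro y
    have : y = ∑ e : Fin m, c e • (β * π ^ (e : ℕ) * y) := by
      calc y = β⁻¹ * (β * y) := by field_simp
        _ = _ := by
          rw [hc, Finset.sum_mul]
          apply Finset.sum_congr rfl
          intro e _
          rw [hB, smul_mul_assoc]; congr 1; ring
    conv_lhs => rw [this]
    simp
  have h1 : ∀ y, qterm π β i y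
      = ∏ e : Fin m, f e (Algebra.trace (ZMod 2) F (β * π ^ (e : ℕ) * y)) := by
    intro y
    simp only [f]
    rw [Finset.prod_mul_distrib, ← chi2_sum, ← htr]
    unfold qterm
    split_ifs with h
    · rw [Finset.prod_eq_one, one_mul]
      intro e _
      split_ifs with h1 h2 h3 h4 <;> try rfl
      · exact absurd (by rw [h1]; simpa using h.1) h2
      · exact absurd (h.2 e (by omega) h3) h4
    · symm
      rw [mul_eq_zero]; left
      rw [Finset.prod_eq_zero_iff]
      by_contra hcon
      push Not at hcon
      apply h
      constructor
      · have := hcon ⟨0, hm⟩ (Finset.mem_univ _)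
        simpa using this
      · intro k hk hk'
        have := hcon ⟨k, by omega⟩ (Finset.mem_univ _)
        simp only [show k ≠ 0 by omega, hk', if_true, if_false] at this
        by_contra h9
        rw [if_neg h9] at this
        exact this rfl
  simp only [h1]
  rw [(phi_bij π β hβ m B hB).sum_comp (fun v => ∏ e : Fin m, f e (v e))]
  have h2 := Finset.prod_univ_sum (fun _ : Fin m => (Finset.univ : Finset (ZMod 2))) f
  rw [Fintype.piFinset_univ] at h2
  rw [← h2]
  have h3 : ∀ e : Fin m, ∑ v, f e v = (if e = ⟨0, hm⟩ then chi2 (c ⟨0, hm⟩) else 1) *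
      (if i ≤ (e : ℕ) then (if c e = 0 then 2 else 0) else 1) := by
    intro e
    have hu : (Finset.univ : Finset (ZMod 2)) = {0, 1} := by decide
    rw [hu, Finset.sum_pair zero_ne_one]
    simp only [f]
    by_cases h0 : (e : ℕ) = 0
    · have : e = ⟨0, hm⟩ := Fin.ext h0
      subst this
      have : ¬ i ≤ 0 := by omega
      simp [this]
    · have h0' : ¬ e = ⟨0, hm⟩ := fun h => h0 (by rw [h])
      by_cases hei : (e : ℕ) < i
      · simp [h0, h0', hei, chi2_zero]
      · rcases zmod2_cases (c e) with h | h
        · simp [h0, h0', hei, not_lt.mp hei, h, chi2_zero]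
        · simp [h0, h0', hei, not_lt.mp hei, h, chi2_zero, chi2_one]
  simp only [h3]
  rw [Finset.prod_mul_distrib]
  congr 1
  · simp
  · split_ifs with h
    · have : ∀ e : Fin m, (if i ≤ (e : ℕ) then (if c e = 0 then (2 : ℤ) else 0) else 1)
          = if i ≤ (e : ℕ) then 2 else 1 := by
        intro e
        split_ifs with h4 h5 <;> first | rfl | exact absurd (h e h4) h5
      simp only [this]
      rw [Fin.prod_univ_eq_prod_range (fun e => if i ≤ e then (2 : ℤ) else 1) m,
        Finset.prod_ite]
      simp only [Finset.prod_const, one_pow, mul_one]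
      congr 1
      have : Finset.filter (fun e => i ≤ e) (Finset.range m) = Finset.Ico i m := by
        ext; simp; omega
      rw [this, Nat.card_Ico]
    · push Not at h
      obtain ⟨e, he, he'⟩ := h
      apply Finset.prod_eq_zero (Finset.mem_univ e)
      rw [if_pos he, if_neg he']

lemma sum_gfun (π β : F) (hπ : π ≠ 0) (hβ : β ≠ 0) (m : ℕ) (hm : 0 < m)
    (B : Module.Basis (Fin m) (ZMod 2) F) (hB : ∀ e, B e = π ^ (e : ℕ))
    (c : Fin m → ZMod 2) (hc : β⁻¹ = ∑ e, c e • B e) (d : Fin m) (hd : c d = 1)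
    (hd' : ∀ e, d < e → c e = 0) :
    ∑ x, gfun π β m x = chi2 (c ⟨0, hm⟩) * (2 ^ (m - (d : ℕ)) - 1) := by
  unfold gfun
  rw [Finset.sum_comm]
  have h1 : ∀ i ∈ Finset.range m, ∑ x, qterm π β (i + 1) ((π ^ (i + 1))⁻¹ * x)
      = chi2 (c ⟨0, hm⟩) * if (d : ℕ) ≤ i then 2 ^ (m - (i + 1)) else 0 := by
    intro i hi
    rw [Finset.mem_range] at hi
    have hb : Function.Bijective (fun x : F => (π ^ (i + 1))⁻¹ * x) :=
      mulLeft_bijective₀ _ (inv_ne_zero (pow_ne_zero _ hπ))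
    rw [hb.sum_comp (fun y => qterm π β (i + 1) y),
      sum_qterm π β hβ m hm B hB c hc (i + 1) (by omega) (by omega)]
    congr 1
    congr 1
    apply propext
    constructor
    · intro h
      by_contra h2
      have := h d (by omega)
      rw [hd] at this
      exact one_ne_zero this
    · intro h e he
      exact hd' e (by rw [Fin.lt_def]; omega)
  rw [Finset.sum_congr rfl h1, ← Finset.mul_sum]
  congr 1
  have hdm := d.2
  generalize (d : ℕ) = d' at hdm
  clear h1 hd hd' hc hm B hB
  rw [← Finset.sum_range_reflect]
  have : ∀ M ≤ m, ∑ j ∈ Finset.range M, (if d' ≤ m - 1 - j then (2 : ℤ) ^ (m - (m - 1 - j + 1)) else 0)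
      = 2 ^ (min M (m - d')) - 1 := by
    intro M
    induction M with
    | zero => simp
    | succ M ih =>
      intro hM
      rw [Finset.sum_range_succ, ih (by omega)]
      split_ifs with h
      · rw [show min M (m - d') = M by omega, show min (M + 1) (m - d') = M + 1 by omega,
          show m - (m - 1 - M + 1) = M by omega, pow_succ]
        ring
      · rw [show min M (m - d') = m - d' by omega, show min (M + 1) (m - d') = m - d' by omega]
        ring
  rw [this m le_rfl]
  congr 2
  omega

end field

section main
set_option linter.unusedSectionVars false
variable {F : Type*} [Field F] [Algebra (ZMod 2) F] [Fintype F]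

lemma char_two_add_self (x : F) : x + x = 0 := by
  have h : (1 : F) + 1 = 0 := by
    have : algebraMap (ZMod 2) F (1 + 1) = 0 := by
      rw [show (1 + 1 : ZMod 2) = 0 by decide, map_zero]
    simpa using this
  calc x + x = (1 + 1) * x := by ring
    _ = 0 := by rw [h, zero_mul]

lemma arithAC_val (π : F) (m n : ℕ) (hm : 0 < m) (hn : 0 < n)
    (hcard : Fintype.card F = n + 1) (hord : orderOf π = n)
    (B : Module.Basis (Fin m) (ZMod 2) F) (hB : ∀ e, B e = π ^ (e : ℕ))
    (τ : ℕ) (hβ : 1 + π ^ τ ≠ 0)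
    (c : Fin m → ZMod 2) (hc : (1 + π ^ τ)⁻¹ = ∑ e, c e • B e) (d : Fin m) (hd : c d = 1)
    (hd' : ∀ e, d < e → c e = 0) :
    arithAC n (fun l => (Algebra.trace (ZMod 2) F (π ^ l)).val) τ
      = chi2 (c ⟨0, hm⟩) * (2 ^ (m - (d : ℕ)) - 1) := by
  have hpn : π ^ n = 1 := by rw [← hord]; exact pow_orderOf_eq_one π
  have hπ : π ≠ 0 := by
    rintro rfl
    rw [zero_pow hn.ne'] at hpn
    exact zero_ne_one hpn
  set β := 1 + π ^ τ with hβd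
  have hrec := gfun_rec π β hπ hβ m hm B hB
  have hval : ∀ a b : ZMod 2, a.val = b.val ↔ ¬ (a + b = 1) := by decide
  have hsplit : ∀ l, Algebra.trace (ZMod 2) F (β * π ^ l)
      = Algebra.trace (ZMod 2) F (π ^ l) + Algebra.trace (ZMod 2) F (π ^ (l + τ)) := by
    intro l
    rw [← map_add]; congr 1; rw [hβd]; ring
  -- a position where the sequences differ
  have hex : ∃ l < n, Algebra.trace (ZMod 2) F (β * π ^ l) = 1 := by
    by_contra hcon
    push Not at hcon
    have : (1 : F) = 0 := by
      apply tr_nondeg π β hβ m B hB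
      intro e he
      have h2 : π ^ e = π ^ (e % n) := by rw [← hord, pow_mod_orderOf]
      rw [mul_one, h2]
      exact (zmod2_cases _).resolve_right (hcon (e % n) (Nat.mod_lt _ hn))
    exact one_ne_zero this
  have hrec' : ∀ l, gfun π β m (π ^ (l + 1)) =
      if Algebra.trace (ZMod 2) F (β * π ^ l) = 1 then
      chi2 (Algebra.trace (ZMod 2) F (π ^ l)) else gfun π β m (π ^ l) := by
    intro l
    rw [pow_succ', hrec]
  have hchi : ∀ z, chi2 z = 1 ∨ chi2 z = -1 := by decide
  have hpm : ∀ l, gfun π β m (π ^ l) = 1 ∨ gfun π β m (π ^ l) = -1 := by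
    obtain ⟨l0, hl0, h0⟩ := hex
    have hge : ∀ j, gfun π β m (π ^ (l0 + 1 + j)) = 1 ∨ gfun π β m (π ^ (l0 + 1 + j)) = -1 := by
      intro j
      induction j with
      | zero => rw [add_zero, hrec', if_pos h0]; exact hchi _
      | succ j ih =>
        rw [← add_assoc, hrec']
        split_ifs
        · exact hchi _
        · exact ih
    intro l
    have := hge (l + (n - (l0 + 1)))
    rw [show l0 + 1 + (l + (n - (l0 + 1))) = l + n by omega, pow_add, hpn, mul_one] at this
    exact this
  rw [arithAC_eq n τ _ _ (fun l => gfun π β m (π ^ l)) hpm]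
  · rw [sum_pow π n hcard hord hn _ (gfun_zero π β m)]
    exact sum_gfun π β hπ hβ m hm B hB c hc d hd hd'
  · intro l
    rw [hrec', hsplit]
    simp only [hval]
    split_ifs <;> first | rfl | contradiction
  · simp only [hpn, pow_zero]
  · have h1 := sum_pow π n hcard hord hn
      (fun x => ((Algebra.trace (ZMod 2) F x).val : ℤ)) (by simp)
    have h2 := sum_pow π n hcard hord hn
      (fun x => ((Algebra.trace (ZMod 2) F (π ^ τ * x)).val : ℤ)) (by simp)
    have hb : Function.Bijective (fun x : F => π ^ τ * x) :=
      mulLeft_bijective₀ _ (pow_ne_zero _ hπ)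
    rw [hb.sum_comp (fun x => ((Algebra.trace (ZMod 2) F x).val : ℤ)), ← h1] at h2
    zify
    rw [← h2]
    apply Finset.sum_congr rfl
    intro l _
    rw [pow_add, mul_comm]
  · obtain ⟨l, hl, h⟩ := hex
    refine ⟨l, hl, ?_⟩
    simp only [ne_eq, hval, not_not]
    rw [← hsplit, h]
  · intro l
    have := ZMod.val_lt (Algebra.trace (ZMod 2) F (π ^ l))
    omega

/-- allowed coefficient values -/
def allowed (m D : ℕ) (z : ZMod 2) (e : Fin m) : Finset (ZMod 2) :=
  if (e : ℕ) = 0 then {z} else if (e : ℕ) < D then Finset.univ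
    else if (e : ℕ) = D then {1} else {0}

lemma card_allowed (m D : ℕ) (hD : 1 ≤ D) (hDm : D < m) (z : ZMod 2) :
    (Fintype.piFinset (allowed m D z)).card = 2 ^ (D - 1) := by
  rw [Fintype.card_piFinset]
  have : ∀ e : Fin m, (allowed m D z e).card
      = if 1 ≤ (e : ℕ) ∧ (e : ℕ) < D then 2 else 1 := by
    intro e
    unfold allowed
    split_ifs <;> first | omega | simp
  simp only [this]
  rw [Fin.prod_univ_eq_prod_range (fun e => if 1 ≤ e ∧ e < D then 2 else 1) m, Finset.prod_ite]
  simp only [Finset.prod_const, one_pow, mul_one]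
  congr 1
  have : Finset.filter (fun e => 1 ≤ e ∧ e < D) (Finset.range m) = Finset.Ico 1 D := by
    ext; simp; omega
  rw [this, Nat.card_Ico]

lemma exists_top (m : ℕ) (c : Fin m → ZMod 2) (h : c ≠ 0) :
    ∃ d, c d = 1 ∧ ∀ e, d < e → c e = 0 := by
  have hne : (Finset.univ.filter (fun e => c e = 1)).Nonempty := by
    by_contra hcon
    rw [Finset.not_nonempty_iff_eq_empty, Finset.filter_eq_empty_iff] at hcon
    apply h
    funext e
    exact (zmod2_cases _).resolve_right (hcon (Finset.mem_univ e))
  refine ⟨_, (Finset.mem_filter.mp (Finset.max'_mem _ hne)).2, fun e he => ?_⟩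
  by_contra h0
  have h1 := (zmod2_cases (c e)).resolve_left h0
  have := Finset.le_max' (Finset.univ.filter (fun e => c e = 1)) e (Finset.mem_filter.mpr ⟨Finset.mem_univ e, h1⟩)
  exact absurd he (not_lt.mpr this)

lemma count_eps (π : F) (m : ℕ) (hm : 2 ≤ m)
    (hcard : Fintype.card F = 2 ^ m) (hfr : Module.finrank (ZMod 2) F = m)
    (hord : orderOf π = 2 ^ m - 1) (k : ℕ) (hk1 : 1 ≤ k) (hk2 : k ≤ m - 1) (z : ZMod 2) :
    Nat.card {τ : ℕ // 1 ≤ τ ∧ τ ≤ 2 ^ m - 2 ∧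
        arithAC (2 ^ m - 1) (fun l => (Algebra.trace (ZMod 2) F (π ^ l)).val) τ
          = chi2 z * (2 ^ k - 1)} = 2 ^ (m - k - 1) := by
  have h4 : 2 ^ 2 ≤ 2 ^ m := Nat.pow_le_pow_right (by norm_num) hm
  obtain ⟨n, hn⟩ : ∃ n, 2 ^ m = n + 1 := ⟨2 ^ m - 1, by omega⟩
  rw [hn] at hcard hord h4 ⊢
  rw [show n + 1 - 2 = n - 1 by omega]
  simp only [Nat.add_sub_cancel] at hord ⊢
  have hn0 : 0 < n := by omega
  obtain ⟨B, hB⟩ := exists_basis π m n hcard hord hn0 hfr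
  have hinj : ∀ a b, a < n → b < n → π ^ a = π ^ b → a = b := by
    intro a b ha hb hab
    exact pow_injOn_Iio_orderOf (x := π) (by simpa [hord] using ha) (by simpa [hord] using hb) hab
  have hm0 : 0 < m := by omega
  have hB0 : B ⟨0, hm0⟩ = 1 := by rw [hB]; simp
  have hβ : ∀ τ, 1 ≤ τ → τ ≤ n - 1 → 1 + π ^ τ ≠ 0 := by
    intro τ h1 h2 h
    have : π ^ τ = π ^ 0 := by
      rw [pow_zero]
      have h3 := char_two_add_self (1 : F)
      exact add_left_cancel (h.trans h3.symm)
    have := hinj τ 0 (by omega) hn0 this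
    omega
  have hchi : ∀ a b, chi2 a = chi2 b → a = b := by decide
  have hchiabs : ∀ a, |chi2 a| = 1 := by decide
  -- characterisation
  have hiff : ∀ τ, 1 ≤ τ → τ ≤ n - 1 →
      (arithAC n (fun l => (Algebra.trace (ZMod 2) F (π ^ l)).val) τ = chi2 z * (2 ^ k - 1) ↔
        B.equivFun ((1 + π ^ τ)⁻¹) ∈ Fintype.piFinset (allowed m (m - k) z)) := by
    intro τ h1 h2
    have hb := hβ τ h1 h2
    set c := B.equivFun ((1 + π ^ τ)⁻¹) with hcd
    have hc : (1 + π ^ τ)⁻¹ = ∑ e, c e • B e := by rw [hcd, B.sum_equivFun]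
    rw [Fintype.mem_piFinset]
    constructor
    · intro h
      have hc0 : c ≠ 0 := by
        rw [hcd]
        intro h0
        rw [LinearEquiv.map_eq_zero_iff] at h0
        exact inv_ne_zero hb h0
      obtain ⟨d, hd, hd'⟩ := exists_top m c hc0
      rw [arithAC_val π m n hm0 hn0 hcard hord B hB τ hb c hc d hd hd'] at h
      have hp : ∀ j : ℕ, |(2 : ℤ) ^ j - 1| = 2 ^ j - 1 := by
        intro j
        apply abs_of_nonneg
        have : (1 : ℤ) ≤ 2 ^ j := one_le_pow₀ (by norm_num)
        linarith
      have habs := congrArg abs h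
      rw [abs_mul, abs_mul, hchiabs, hchiabs, hp, hp, one_mul, one_mul] at habs
      have hpow : (2 : ℕ) ^ (m - (d : ℕ)) = 2 ^ k := by
        zify; linarith
      have hmd := Nat.pow_right_injective (le_refl 2) hpow
      have hpk : (2 : ℤ) ^ k - 1 ≠ 0 := by
        have : (2 : ℤ) ^ 1 ≤ 2 ^ k := pow_le_pow_right₀ (by norm_num) hk1
        linarith
      have hdlt := d.2
      replace hmd : m - (d : ℕ) = k := hmd
      rw [hmd] at h
      have hz := hchi _ _ (mul_right_cancel₀ hpk h)
      intro e
      unfold allowed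
      split_ifs with e1 e2 e3
      · rw [show e = ⟨0, hm0⟩ from Fin.ext e1, hz]; simp
      · simp
      · rw [show e = d from Fin.ext (by omega), hd]; simp
      · rw [hd' e (by rw [Fin.lt_def]; omega)]; simp
    · intro h
      have hd := h ⟨m - k, by omega⟩
      have hz := h ⟨0, hm0⟩
      have hne : m - k ≠ 0 := by omega
      simp [allowed, hne] at hd
      simp [allowed] at hz
      rw [arithAC_val π m n hm0 hn0 hcard hord B hB τ hb c hc ⟨m - k, by omega⟩ hd, hz]
      · simp only
        rw [show m - (m - k) = k by omega]
      · intro e he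
        rw [Fin.lt_def] at he
        simp only at he
        have := h e
        unfold allowed at this
        rw [if_neg (by omega), if_neg (by omega), if_neg (by omega)] at this
        simpa using this
  rw [← card_allowed m (m - k) (by omega) (by omega) z, ← Fintype.card_coe,
    ← Nat.card_eq_fintype_card]
  refine Nat.card_eq_of_bijective (fun τ => ⟨B.equivFun ((1 + π ^ (τ : ℕ))⁻¹),
    (hiff τ.1 τ.2.1 τ.2.2.1).mp τ.2.2.2⟩) ⟨?_, ?_⟩
  · rintro ⟨a, ha1, ha2, _⟩ ⟨b, hb1, hb2, _⟩ hab
    have h1 := B.equivFun.injective (congrArg Subtype.val hab)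
    have h2 := add_left_cancel (inv_injective h1)
    exact Subtype.ext (hinj a b (by omega) (by omega) h2)
  · rintro ⟨c, hc⟩
    have hc' := Fintype.mem_piFinset.mp hc (⟨m - k, by omega⟩ : Fin m)
    have hne : m - k ≠ 0 := by omega
    simp [allowed, hne] at hc'
    set x := B.equivFun.symm c with hx
    have hxc : B.equivFun x = c := by rw [hx, LinearEquiv.apply_symm_apply]
    have hx0 : x ≠ 0 := by
      intro h
      rw [h, map_zero] at hxc
      rw [← hxc] at hc'
      exact zero_ne_one hc'
    have hx1 : x ≠ 1 := by
      intro h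
      rw [h, ← hB0] at hxc
      rw [← hxc] at hc'
      have hk : (⟨0, hm0⟩ : Fin m) ≠ ⟨m - k, by omega⟩ := by
        intro h; exact hne (congrArg Fin.val h).symm
      simp [Finsupp.single_apply, hk, hne, hne.symm] at hc'
    have hy : 1 + x⁻¹ ≠ 0 := by
      intro h
      have h3 := add_left_cancel (h.trans (char_two_add_self (1 : F)).symm)
      exact hx1 (inv_eq_one.mp h3)
    obtain ⟨τ, hτ, hτx⟩ := exists_pow π n hcard hord hn0 _ hy
    have hinv : (1 + π ^ τ)⁻¹ = x := by
      rw [hτx, ← add_assoc, char_two_add_self, zero_add, inv_inv]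
    have hτ1 : 1 ≤ τ := by
      by_contra h
      have : τ = 0 := by omega
      rw [this, pow_zero, char_two_add_self, inv_zero] at hinv
      exact hx0 hinv.symm
    refine ⟨⟨τ, hτ1, by omega, (hiff τ hτ1 (by omega)).mpr ?_⟩, ?_⟩
    · rw [hinv, hxc]; exact hc
    · apply Subtype.ext
      simp only [hinv, hxc]

end main

theorem mseq_arithAC_distribution (m : ℕ) (hm : 2 ≤ m)
    (π : GaloisField 2 m) (hπ : orderOf π = 2 ^ m - 1)
    (s : ℕ → ZMod 2)
    (hs : ∀ l, s l = Algebra.trace (ZMod 2) (GaloisField 2 m) (π ^ l))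
    (k : ℕ) (hk1 : 1 ≤ k) (hk2 : k ≤ m - 1) :
    (∀ ε : ℤ, ε = 1 ∨ ε = -1 →
      Nat.card {τ : ℕ // 1 ≤ τ ∧ τ ≤ 2 ^ m - 2 ∧
          arithAC (2 ^ m - 1) (fun l => (s l).val) τ = ε * (2 ^ k - 1)}
        = 2 ^ (m - k - 1)) ∧
    Nat.card {τ : ℕ // 1 ≤ τ ∧ τ ≤ 2 ^ m - 2 ∧
        |arithAC (2 ^ m - 1) (fun l => (s l).val) τ| = 2 ^ k - 1}
      = 2 ^ (m - k) := by
  obtain rfl : s = fun l => Algebra.trace (ZMod 2) (GaloisField 2 m) (π ^ l) := funext hs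
  letI : Fintype (GaloisField 2 m) := Fintype.ofFinite _
  have hcard : Fintype.card (GaloisField 2 m) = 2 ^ m := by
    rw [← Nat.card_eq_fintype_card, GaloisField.card 2 m (by omega)]
  have hfr := GaloisField.finrank 2 (n := m) (by omega)
  have main := count_eps π m hm hcard hfr hπ k hk1 hk2
  have h1 := main 0
  have h2 := main 1
  rw [chi2_zero] at h1
  rw [chi2_one] at h2
  refine ⟨?_, ?_⟩
  · rintro ε (rfl | rfl)
    · exact h1
    · exact h2
  · generalize arithAC (2 ^ m - 1)
      (fun l => (Algebra.trace (ZMod 2) (GaloisField 2 m) (π ^ l)).val) = A at h1 h2 ⊢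
    have hpk : (0 : ℤ) < 2 ^ k - 1 := by
      have : (2 : ℤ) ^ 1 ≤ 2 ^ k := pow_le_pow_right₀ (by norm_num) hk1
      linarith
    generalize (2 : ℤ) ^ k - 1 = v at h1 h2 hpk ⊢
    have conv : ∀ P : ℤ → Prop, ∀ [DecidablePred P],
        Nat.card {τ : ℕ // 1 ≤ τ ∧ τ ≤ 2 ^ m - 2 ∧ P (A τ)}
        = ((Finset.Icc 1 (2 ^ m - 2)).filter (fun τ => P (A τ))).card := by
      intro P _
      apply Nat.subtype_card
      intro x
      simp [and_assoc]
    rw [conv (fun x => x = 1 * v)] at h1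
    rw [conv (fun x => x = -1 * v)] at h2
    rw [conv (fun x => |x| = v), show m - k = (m - k - 1) + 1 by omega, pow_succ, mul_two]
    nth_rewrite 1 [← h1]
    rw [← h2, ← Finset.card_union_of_disjoint, ← Finset.filter_or]
    · congr 1
      apply Finset.filter_congr
      intro x _
      rw [abs_eq hpk.le, one_mul, neg_one_mul]
    · rw [Finset.disjoint_filter]
      intro x _ h3 h4
      linarith
end
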